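/- arXiv:2402.11440 — 2 statements merged into one kernel-verified Lean document; each statement's English description precedes it below -/
import Mathlib

section
/- For every configuration p of k labeled tiles on an m×n board, every tile t, and every direction d, the max(m,n)-fold iterate of the particle step for (t,d) applied to p is d(t)-terminal; that is, applying the particle step for (t,d) once more to this iterate leaves it unchanged. (This shows the particle tilt operation of Ricochet Robots is well defined: maximal sliding terminates within max(m,n) unit steps.) -/
/-- The four cardinal directions. -/
inductive Dir : Type
  | N | E | S | W

/-- The unit vector corresponding to a direction. -/
def Dir.vec : Dir → ℤ × ℤ
  | .N => (-1, 0)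
  | .S => (1, 0)
  | .E => (0, 1)
  | .W => (0, -1)

/-- Move a cell of an `m × n` board one unit in direction `d`,
returning `none` if this leaves the board. -/
def Dir.move {m n : ℕ} (d : Dir) (q : Fin m × Fin n) : Option (Fin m × Fin n) :=
  if h : 0 ≤ (q.1 : ℤ) + d.vec.1 ∧ (q.1 : ℤ) + d.vec.1 < m ∧
      0 ≤ (q.2 : ℤ) + d.vec.2 ∧ (q.2 : ℤ) + d.vec.2 < n then
    some (⟨((q.1 : ℤ) + d.vec.1).toNat, by omega⟩, ⟨((q.2 : ℤ) + d.vec.2).toNat, by omega⟩)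
  else none

/-- The particle step for tile `t` in direction `d`: move tile `t` one unit in
direction `d` provided the target cell is on the board, not blocked (not in `W`),
and not occupied by another tile; otherwise do nothing. -/
def particleStep {m n k : ℕ} (W : Set (Fin m × Fin n)) [DecidablePred (· ∈ W)]
    (t : Fin k) (d : Dir) (p : Fin k → Fin m × Fin n) : Fin k → Fin m × Fin n :=
  match d.move (p t) with
  | none => p
  | some q => if q ∈ W ∨ ∃ s, s ≠ t ∧ p s = q then p else Function.update p t q

/-- The particle tilt for tile `t` in direction `d`: iterate the particle step
`max m n` times (maximal sliding). -/
def particleTilt {m n k : ℕ} (W : Set (Fin m × Fin n)) [DecidablePred (· ∈ W)]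
    (t : Fin k) (d : Dir) (p : Fin k → Fin m × Fin n) : Fin k → Fin m × Fin n :=
  (particleStep W t d)^[max m n] p

/-- `C →₁ C'`: one particle tilt transforms `C` into `C'`. -/
def OneMove {m n k : ℕ} (W : Set (Fin m × Fin n)) [DecidablePred (· ∈ W)]
    (p p' : Fin k → Fin m × Fin n) : Prop :=
  ∃ (t : Fin k) (d : Dir), p' = particleTilt W t d p

/-- The set of configurations of `k` labeled tiles on the board with blocked set `W`. -/
def Config {m n : ℕ} (W : Set (Fin m × Fin n)) (k : ℕ) : Set (Fin k → Fin m × Fin n) :=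
  {p | Function.Injective p ∧ ∀ i, p i ∉ W}

/-- A map that strictly decreases a natural-valued measure off its fixed points reaches a
fixed point after as many iterations as the measure of the starting point. -/
theorem iterate_fixed_of_measure_le {α : Type*} (f : α → α) (μ : α → ℕ)
    (hf : ∀ x, f x = x ∨ μ (f x) < μ x) (N : ℕ) (x : α) (hx : μ x ≤ N) :
    f (f^[N] x) = f^[N] x := by
  induction N generalizing x with
  | zero => exact (hf x).resolve_right (by omega)
  | succ N ih =>
    rw [Function.iterate_succ_apply]
    rcases hf x with h | h
    · rw [h, Function.iterate_fixed h, h]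
    · exact ih (f x) (by omega)

/-- The number of cells between `q` and the edge of the board in direction `d`. -/
def Dir.clearance {m n : ℕ} (d : Dir) (q : Fin m × Fin n) : ℕ :=
  match d with
  | .N => q.1
  | .S => m - 1 - q.1
  | .E => n - 1 - q.2
  | .W => q.2

theorem Dir.clearance_le_max {m n : ℕ} (d : Dir) (q : Fin m × Fin n) :
    d.clearance q ≤ max m n := by
  cases d <;> simp only [Dir.clearance] <;> omega

theorem Dir.clearance_lt_of_move_eq_some {m n : ℕ} {d : Dir} {q r : Fin m × Fin n}
    (h : d.move q = some r) : d.clearance r < d.clearance q := by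
  unfold Dir.move at h
  split_ifs at h with hb
  obtain rfl := Option.some.inj h
  cases d <;> simp only [Dir.clearance, Dir.vec] at hb ⊢ <;> omega

theorem particleStep_eq_self_or_clearance_lt {m n k : ℕ} (W : Set (Fin m × Fin n))
    [DecidablePred (· ∈ W)] (t : Fin k) (d : Dir) (p : Fin k → Fin m × Fin n) :
    particleStep W t d p = p ∨ d.clearance (particleStep W t d p t) < d.clearance (p t) := by
  rcases hq : d.move (p t) with _ | q
  · left
    simp only [particleStep, hq]
  · by_cases hb : q ∈ W ∨ ∃ s, s ≠ t ∧ p s = q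
    · left
      simp only [particleStep, hq, if_pos hb]
    · right
      simp only [particleStep, hq, if_neg hb, Function.update_self]
      exact Dir.clearance_lt_of_move_eq_some hq

/-- the `max m n`-fold iterate of the particle step for `(t, d)`
applied to a configuration is `d(t)`-terminal: applying the particle step once
more leaves it unchanged.  (Maximal sliding terminates within `max m n` steps.) -/
theorem particleTilt_terminal {m n k : ℕ} (W : Set (Fin m × Fin n))
    [DecidablePred (· ∈ W)] (p : Fin k → Fin m × Fin n)
    (hinj : Function.Injective p) (hW : ∀ i, p i ∉ W) (t : Fin k) (d : Dir) :
    particleStep W t d ((particleStep W t d)^[max m n] p) =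
      (particleStep W t d)^[max m n] p :=
  iterate_fixed_of_measure_le _ (fun p => d.clearance (p t))
    (particleStep_eq_self_or_clearance_lt W t d) _ p (d.clearance_le_max (p t))
end

section
/- The particle tilt operation is idempotent: for every configuration p of k labeled tiles on an m×n board, every tile t, and every direction d, applying the particle tilt for (t,d) twice to p gives the same configuration as applying it once. -/
/-- Iterating a map that strictly decreases `μ` off its fixed points reaches a fixed point within
`μ x` steps. -/
theorem Function.isFixedPt_iterate_of_decreasing {α : Type*} {f : α → α} (μ : α → ℕ)
    (hμ : ∀ x, f x ≠ x → μ (f x) < μ x) {N : ℕ} {x : α} (hx : μ x ≤ N) :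
    Function.IsFixedPt f (f^[N] x) := by
  induction N generalizing x with
  | zero =>
    by_contra h
    exact absurd (hμ x h) (by omega)
  | succ N ih =>
    by_cases h : f x = x
    · rw [Function.iterate_fixed h]
      exact h
    · rw [Function.iterate_succ_apply]
      exact ih (by have := hμ x h; omega)

/-- The number of cells of the board lying beyond `q` in direction `d`. -/
def Dir.room {m n : ℕ} (d : Dir) (q : Fin m × Fin n) : ℕ :=
  match d with
  | .N => q.1
  | .S => m - 1 - q.1
  | .E => n - 1 - q.2
  | .W => q.2

theorem Dir.room_le_max {m n : ℕ} (d : Dir) (q : Fin m × Fin n) : d.room q ≤ max m n := by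
  cases d <;> simp only [Dir.room] <;> omega

theorem Dir.room_lt_of_move_eq_some {m n : ℕ} {d : Dir} {q r : Fin m × Fin n}
    (h : d.move q = some r) : d.room r < d.room q := by
  unfold Dir.move at h
  split_ifs at h with hb
  obtain rfl := Option.some.inj h
  cases d <;> simp only [Dir.room, Dir.vec] at hb ⊢ <;> omega

theorem room_particleStep_lt {m n k : ℕ} (W : Set (Fin m × Fin n)) [DecidablePred (· ∈ W)]
    (t : Fin k) (d : Dir) (p : Fin k → Fin m × Fin n) (h : particleStep W t d p ≠ p) :
    d.room (particleStep W t d p t) < d.room (p t) := by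
  unfold particleStep at h ⊢
  split at h
  · exact absurd rfl h
  · rename_i q hq
    split_ifs at h ⊢ with hc
    · exact absurd rfl h
    · simpa [hq, hc] using Dir.room_lt_of_move_eq_some hq

/-- the particle tilt operation is idempotent: applying the particle
tilt for `(t, d)` twice to a configuration gives the same result as applying it once. -/
theorem particleTilt_idempotent {m n k : ℕ} (W : Set (Fin m × Fin n))
    [DecidablePred (· ∈ W)] (p : Fin k → Fin m × Fin n)
    (hinj : Function.Injective p) (hW : ∀ i, p i ∉ W) (t : Fin k) (d : Dir) :
    particleTilt W t d (particleTilt W t d p) = particleTilt W t d p := by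
  exact Function.iterate_fixed (Function.isFixedPt_iterate_of_decreasing (fun p => d.room (p t))
    (room_particleStep_lt W t d) (d.room_le_max (p t))) _
end
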